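/- Let G be a graph on n vertices (n ≥ 1) with every edge directed from its lower-indexed to its higher-indexed endpoint, let q be a positive integer, and suppose G has a proper q-coloring. Choose a weight function ω : V(G) × [q] → {1,…,2nq} uniformly at random (all values independent and uniform). For z ∈ ℤ define P_G(z) = Σ_{x ∈ [q]^{V(G)}, ω(x) = z} ∏_{(u,v) ∈ E(G)} (x_u − x_v). Then with probability at least 1/2 there exists z ∈ ℤ with P_G(z) ≠ 0. -/

import Mathlib

section Isolation

variable {α : Type*}

/-- `S` has minimum total weight among the members of the family `F`. -/
def IsMinWeight {N : ℕ} (F : Finset (Finset α)) (ω : α → Fin N) (S : Finset α) : Prop :=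
  S ∈ F ∧ ∀ T ∈ F, ∑ a ∈ S, (ω a : ℕ) ≤ ∑ a ∈ T, (ω a : ℕ)

/-- The weight at `e` does not decide whether a minimum-weight member of `F` contains `e`. -/
def IsAmbiguous {N : ℕ} (F : Finset (Finset α)) (e : α) (ω : α → Fin N) : Prop :=
  ∃ S T, IsMinWeight F ω S ∧ IsMinWeight F ω T ∧ e ∈ S ∧ e ∉ T

theorem IsAmbiguous.not_lt {N : ℕ} {F : Finset (Finset α)} {e : α} {ω η : α → Fin N}
    (hω : IsAmbiguous F e ω) (hη : IsAmbiguous F e η) (h : ∀ a, a ≠ e → ω a = η a) :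
    ¬ ω e < η e := by
  classical
  intro hlt
  obtain ⟨S, T, hS, hT, heS, heT⟩ := hω
  obtain ⟨S', T', hS', hT', heS', heT'⟩ := hη
  have off : ∀ U : Finset α, e ∉ U → ∑ a ∈ U, (ω a : ℕ) = ∑ a ∈ U, (η a : ℕ) := by
    intro U hU
    refine Finset.sum_congr rfl fun a ha => ?_
    rw [h a (by rintro rfl; exact hU ha)]
  have h1 := hS.2 S' hS'.1
  have h2 := hS'.2 T hT.1
  have h3 := hT.2 S hS.1
  have h4 := off T heT
  have h5 := off (S'.erase e) (Finset.notMem_erase e S')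
  have h6 := Finset.add_sum_erase S' (fun a => (ω a : ℕ)) heS'
  have h7 := Finset.add_sum_erase S' (fun a => (η a : ℕ)) heS'
  have h8 : (ω e : ℕ) < η e := hlt
  omega

variable [Fintype α] [DecidableEq α]

open Classical in
theorem card_isAmbiguous_mul_le {N : ℕ} (F : Finset (Finset α)) (e : α) :
    (Finset.univ.filter fun ω : α → Fin N => IsAmbiguous F e ω).card * N
      ≤ N ^ Fintype.card α := by
  have hcard : (Finset.univ.filter fun ω : α → Fin N => IsAmbiguous F e ω).card
      ≤ (Finset.univ : Finset ({a // a ≠ e} → Fin N)).card := by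
    refine Finset.card_le_card_of_injOn (fun ω a => ω a) (fun _ _ => Finset.mem_univ _) ?_
    intro ω hω η hη hωη
    have hω' : IsAmbiguous F e ω := by simpa using hω
    have hη' : IsAmbiguous F e η := by simpa using hη
    have hoff : ∀ a, a ≠ e → ω a = η a := fun a ha => congrFun hωη ⟨a, ha⟩
    funext a
    by_cases ha : a = e
    · subst ha
      exact le_antisymm (not_lt.1 (hη'.not_lt hω' fun b hb => (hoff b hb).symm))
        (not_lt.1 (hω'.not_lt hη' hoff))
    · exact hoff a ha
  have hpos : 0 < Fintype.card α := Fintype.card_pos_iff.2 ⟨e⟩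
  calc _ ≤ N ^ (Fintype.card α - 1) * N := by
        refine Nat.mul_le_mul_right N (hcard.trans_eq ?_)
        simp [Finset.card_univ]
    _ = N ^ Fintype.card α := by rw [← pow_succ, Nat.sub_add_cancel hpos]

/-- **Isolation lemma**: few weight functions admit two distinct minimum-weight members of `F`. -/
theorem card_not_isolating_mul_le {N : ℕ} (F : Finset (Finset α))
    (B : Finset (α → Fin N))
    (hB : ∀ ω ∈ B, ∃ S T, IsMinWeight F ω S ∧ IsMinWeight F ω T ∧ S ≠ T) :
    B.card * N ≤ Fintype.card α * N ^ Fintype.card α := by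
  classical
  have hsub : B ⊆ Finset.univ.biUnion fun e : α =>
      Finset.univ.filter fun ω : α → Fin N => IsAmbiguous F e ω := by
    intro ω hω
    obtain ⟨S, T, hS, hT, hne⟩ := hB ω hω
    simp only [Finset.mem_biUnion, Finset.mem_univ, true_and, Finset.mem_filter]
    by_contra hcon
    push Not at hcon
    refine hne (Finset.ext fun e => ⟨fun he => ?_, fun he => ?_⟩)
    · by_contra he'
      exact hcon e ⟨S, T, hS, hT, he, he'⟩
    · by_contra he'
      exact hcon e ⟨T, S, hT, hS, he, he'⟩
  calc B.card * N
      ≤ (∑ e : α, (Finset.univ.filter fun ω : α → Fin N => IsAmbiguous F e ω).card) * N :=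
        Nat.mul_le_mul_right N ((Finset.card_le_card hsub).trans Finset.card_biUnion_le)
    _ = ∑ e : α, (Finset.univ.filter fun ω : α → Fin N => IsAmbiguous F e ω).card * N :=
        Finset.sum_mul _ _ _
    _ ≤ ∑ _e : α, N ^ Fintype.card α :=
        Finset.sum_le_sum fun e _ => card_isAmbiguous_mul_le F e
    _ = Fintype.card α * N ^ Fintype.card α := by simp

end Isolation

/-- The graph of a function, as a finite set of pairs. -/
def graphFinset {V C : Type*} [Fintype V] (x : V → C) : Finset (V × C) :=
  Finset.univ.map ⟨fun v => (v, x v), fun _ _ h => congrArg Prod.fst h⟩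

theorem graphFinset_injective {V C : Type*} [Fintype V] :
    Function.Injective (graphFinset : (V → C) → Finset (V × C)) := by
  intro x y h
  funext v
  have hv : (v, x v) ∈ graphFinset y := h ▸ Finset.mem_map.2 ⟨v, Finset.mem_univ v, rfl⟩
  obtain ⟨w, -, hw⟩ := Finset.mem_map.1 hv
  obtain ⟨rfl, hxy⟩ := Prod.mk.inj hw
  exact hxy.symm

theorem prod_color_sub_ne_zero_iff {n q : ℕ} (G : SimpleGraph (Fin n)) [DecidableRel G.Adj]
    (x : Fin n → Fin q) :
    ∏ e ∈ Finset.univ.filter (fun e : Fin n × Fin n => G.Adj e.1 e.2 ∧ e.1 < e.2),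
        (((x e.1 : ℕ) : ℤ) - ((x e.2 : ℕ) : ℤ)) ≠ 0 ↔
      ∀ a b : Fin n, G.Adj a b → x a ≠ x b := by
  rw [Finset.prod_ne_zero_iff]
  simp only [Finset.mem_filter, Finset.mem_univ, true_and, ne_eq, sub_eq_zero, Nat.cast_inj,
    Fin.val_inj, and_imp, Prod.forall]
  refine ⟨fun h a b hab => ?_, fun h a b hab _ => h a b hab⟩
  rcases lt_or_gt_of_ne hab.ne with hlt | hlt
  · exact h a b hab hlt
  · exact fun hx => h b a hab.symm hlt hx.symm


/-- Let `G` be a graph on `n ≥ 1` vertices with edges directed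
from lower to higher index, `q ≥ 1`, and suppose `G` has a proper `q`-coloring.
Choose a weight function `ω : V × [q] → {1, …, 2nq}` uniformly at random
(modelled by a uniform random `f : Fin n × Fin q → Fin (2nq)`, with
`ω(v,c) = f(v,c) + 1`). For `z ∈ ℤ` let
`P_G(z) = Σ_{x ∈ [q]^V, ω(x) = z} ∏_{(u,v) ∈ E(G)} (x_u − x_v)`.
Then with probability at least `1/2` there exists `z` with `P_G(z) ≠ 0`. -/
theorem stmt_14 {n q : ℕ} (hn : 1 ≤ n) (hq : 0 < q)
    (G : SimpleGraph (Fin n)) [DecidableRel G.Adj]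
    (hcol : ∃ f : Fin n → Fin q, ∀ a b : Fin n, G.Adj a b → f a ≠ f b) :
    (1 : ℚ) / 2 ≤
      (Nat.card {ω : Fin n × Fin q → Fin (2 * n * q) //
          ∃ z : ℤ,
            (∑ x ∈ Finset.univ.filter
                (fun x : Fin n → Fin q =>
                  (∑ v : Fin n, (((ω (v, x v) : ℕ) : ℤ) + 1)) = z),
              ∏ e ∈ Finset.univ.filter
                  (fun e : Fin n × Fin n => G.Adj e.1 e.2 ∧ e.1 < e.2),
                (((x e.1 : ℕ) : ℤ) - ((x e.2 : ℕ) : ℤ))) ≠ 0} : ℚ) /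
        (Fintype.card (Fin n × Fin q → Fin (2 * n * q)) : ℚ) := by
  classical
  set g : (Fin n → Fin q) → ℤ := fun x =>
    ∏ e ∈ Finset.univ.filter (fun e : Fin n × Fin n => G.Adj e.1 e.2 ∧ e.1 < e.2),
      (((x e.1 : ℕ) : ℤ) - ((x e.2 : ℕ) : ℤ))
  set Q : (Fin n × Fin q → Fin (2 * n * q)) → Prop := fun ω =>
    ∃ z : ℤ, (∑ x ∈ Finset.univ.filter (fun x : Fin n → Fin q =>
      (∑ v : Fin n, (((ω (v, x v) : ℕ) : ℤ) + 1)) = z), g x) ≠ 0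
  change (1 : ℚ) / 2 ≤ (Nat.card {ω // Q ω} : ℚ) / _
  set P : Finset (Fin n → Fin q) := Finset.univ.filter fun x => g x ≠ 0
  have hPne : P.Nonempty := by
    obtain ⟨f, hf⟩ := hcol
    exact ⟨f, Finset.mem_filter.2 ⟨Finset.mem_univ f, (prod_color_sub_ne_zero_iff G f).2 hf⟩⟩
  have hbad := card_not_isolating_mul_le (P.image graphFinset)
    (Finset.univ.filter fun ω => ¬ Q ω) (by
      intro ω hω
      have hω' : ¬ Q ω := by simpa using hω
      set w : (Fin n → Fin q) → ℕ := fun x => ∑ v, (ω (v, x v) : ℕ)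
      have hsum : ∀ x, ∑ a ∈ graphFinset x, (ω a : ℕ) = w x := fun x =>
        Finset.sum_map _ _ _
      obtain ⟨x, hx, hmin⟩ := P.exists_min_image w hPne
      have hminw : ∀ y ∈ P, w y = w x →
          IsMinWeight (P.image graphFinset) ω (graphFinset y) := by
        intro y hy hyx
        refine ⟨Finset.mem_image_of_mem _ hy, fun T hT => ?_⟩
        obtain ⟨t, ht, rfl⟩ := Finset.mem_image.1 hT
        rw [hsum, hsum, hyx]
        exact hmin t ht
      by_contra hcon
      push Not at hcon
      refine hω' ⟨∑ v : Fin n, (((ω (v, x v) : ℕ) : ℤ) + 1), ?_⟩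
      rw [Finset.sum_eq_single_of_mem x (by simp)]
      · exact (Finset.mem_filter.1 hx).2
      · intro y hy hyx
        by_contra hgy
        have hyP : y ∈ P := Finset.mem_filter.2 ⟨Finset.mem_univ y, hgy⟩
        have hwy : w y = w x := by
          have h := (Finset.mem_filter.1 hy).2
          simp only [Finset.sum_add_distrib, add_left_inj] at h
          exact_mod_cast h
        exact hyx (graphFinset_injective
          (hcon _ _ (hminw y hyP hwy) (hminw x hx rfl))))
  have hsplit := Finset.card_filter_add_card_filter_not
    (s := (Finset.univ : Finset (Fin n × Fin q → Fin (2 * n * q)))) Q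
  have hcard : Nat.card {ω // Q ω} = (Finset.univ.filter Q).card := by
    rw [Nat.card_eq_fintype_card, Fintype.card_subtype]
  have htotal : Fintype.card (Fin n × Fin q → Fin (2 * n * q)) = (2 * n * q) ^ (n * q) := by
    simp
  rw [Finset.card_univ, htotal] at hsplit
  simp only [Fintype.card_prod, Fintype.card_fin] at hbad
  have hnq : 0 < n * q := Nat.mul_pos hn hq
  have hhalf : (Finset.univ.filter fun ω => ¬ Q ω).card * 2 ≤ (2 * n * q) ^ (n * q) := by
    refine Nat.le_of_mul_le_mul_left ?_ hnq
    calc _ = (Finset.univ.filter fun ω => ¬ Q ω).card * (2 * n * q) := by ring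
      _ ≤ _ := hbad
  have hpos : 0 < (2 * n * q) ^ (n * q) := pow_pos (by rw [mul_assoc]; omega) _
  rw [hcard, htotal, div_le_div_iff₀ two_pos (by exact_mod_cast hpos)]
  have : 1 * (2 * n * q) ^ (n * q) ≤ (Finset.univ.filter Q).card * 2 := by omega
  exact_mod_cast this
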